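/- Suppose A_1, …, A_r are stable and A_{r+1}, …, A_k are unstable (1 ≤ r < k), and let s_1, …, s_p be the simple loops of G. For each simple loop s_i set ρ_i = Π_{(u,v)∈E(s_i)} ‖P_v⁻¹P_u‖, λ_{s_i} = Σ_{(u,v)∈E(s_i), u∈{1,…,r}} λ_u, and μ_{s_i} = Σ_{(u,v)∈E(s_i), u∈{r+1,…,k}} μ_u. If for every i ∈ {1,…,p} one has ln ρ_i − λ_{s_i}·τ + μ_{s_i}·η < 0, then the switched system is asymptotically stable for every signal σ ∈ S_G(τ, η). -/

import Mathlib

open Matrix Filter Topology Finset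

attribute [local instance] Classical.propDecidable

noncomputable section

/-- The spectral (ℓ² operator) norm of a complex square matrix. -/
def sNorm {n : ℕ} (M : Matrix (Fin n) (Fin n) ℂ) : ℝ :=
  ‖Matrix.toEuclideanCLM (𝕜 := ℂ) M‖

/-- The spectral (ℓ² operator) norm of a real square matrix. -/
def sNormR {n : ℕ} (M : Matrix (Fin n) (Fin n) ℝ) : ℝ :=
  ‖Matrix.toEuclideanCLM (𝕜 := ℝ) M‖

/-- The ordered product `exp(A_{σ_m}(t_m - t_{m-1})) ⋯ exp(A_{σ_1} t_1)` of the switched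
system (0-based: `flow A t v m = exp((t m - t (m-1)) • A (v (m-1))) * ⋯ * exp((t 1 - t 0) • A (v 0))`). -/
def flow {n k : ℕ} (A : Fin k → Matrix (Fin n) (Fin n) ℝ)
    (t : ℕ → ℝ) (v : ℕ → Fin k) : ℕ → Matrix (Fin n) (Fin n) ℝ
  | 0 => 1
  | m + 1 => NormedSpace.exp ((t (m + 1) - t m) • A (v m)) * flow A t v m

/-- Piecewise evaluation: the value `f m` on the interval `[t m, t (m+1))`. -/
def pc {α : Type*} (t : ℕ → ℝ) (f : ℕ → α) (d : α) (s : ℝ) : α :=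
  if h : ∃ m, t m ≤ s ∧ s < t (m + 1) then f h.choose else d

/-- The solution of the switched system `x' = A_{σ(t)} x`, `x(0) = x0`:
for `s ∈ [t m, t (m+1))`, `x(s) = exp((s - t m) • A (v m)) * flow A t v m * x0`. -/
def sol {n k : ℕ} (A : Fin k → Matrix (Fin n) (Fin n) ℝ)
    (t : ℕ → ℝ) (v : ℕ → Fin k) (x0 : EuclideanSpace ℝ (Fin n)) (s : ℝ) :
    EuclideanSpace ℝ (Fin n) :=
  pc t (fun m => Matrix.toEuclideanCLM (𝕜 := ℝ)
    (NormedSpace.exp ((s - t m) • A (v m)) * flow A t v m) x0) 0 s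

/-- A `G`-admissible switching signal: `t 0 = 0`, strictly increasing switching times tending
to infinity, and consecutive vertices joined by edges of `G`.  Here `v m` is the vertex active
on `[t m, t (m+1))` (i.e. `v m = σ_{m+1}` in 1-based notation). -/
def Admissible {k : ℕ} (E : Set (Fin k × Fin k)) (t : ℕ → ℝ) (v : ℕ → Fin k) : Prop :=
  t 0 = 0 ∧ StrictMono t ∧ Tendsto t atTop atTop ∧ ∀ m, (v m, v (m + 1)) ∈ E

/-- A real matrix is stable if all its (complex) eigenvalues have negative real part. -/
def MStable {n : ℕ} (M : Matrix (Fin n) (Fin n) ℝ) : Prop :=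
  ∀ z ∈ spectrum ℂ (M.map (Complex.ofReal)), z.re < 0

/-- A real matrix is unstable if some eigenvalue has positive real part and no eigenvalue has
zero real part. -/
def MUnstable {n : ℕ} (M : Matrix (Fin n) (Fin n) ℝ) : Prop :=
  (∃ z ∈ spectrum ℂ (M.map (Complex.ofReal)), 0 < z.re) ∧
    ∀ z ∈ spectrum ℂ (M.map (Complex.ofReal)), z.re ≠ 0

/-- `a` is the maximum of the real parts of the eigenvalues of `M`. -/
def MaxRe {n : ℕ} (M : Matrix (Fin n) (Fin n) ℝ) (a : ℝ) : Prop :=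
  IsGreatest (Complex.re '' spectrum ℂ (M.map (Complex.ofReal))) a

/-- `M = P D P⁻¹` with `P` invertible and `D` diagonal (diagonalizability over `ℂ`). -/
def Diagonalized {n : ℕ} (M : Matrix (Fin n) (Fin n) ℝ)
    (P D : Matrix (Fin n) (Fin n) ℂ) : Prop :=
  IsUnit P ∧ D.IsDiag ∧ M.map (Complex.ofReal) = P * D * P⁻¹

/-- Asymptotic stability of the switched system for the given signal. -/
def AsympStable {n k : ℕ} (A : Fin k → Matrix (Fin n) (Fin n) ℝ)
    (t : ℕ → ℝ) (v : ℕ → Fin k) : Prop :=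
  ∀ x0 : EuclideanSpace ℝ (Fin n), Tendsto (fun s => ‖sol A t v x0 s‖) atTop (𝓝 0)

/-- Membership in the class `S_G(τ, η)`: dwell time at least `τ` in the stable subsystems
(indices `< r`), flee time at most `η` in the unstable subsystems (indices `≥ r`). -/
def InSG {k : ℕ} (r : ℕ) (τ η : ℝ) (t : ℕ → ℝ) (v : ℕ → Fin k) : Prop :=
  ∀ m, ((v m).1 < r → τ ≤ t (m + 1) - t m) ∧ (r ≤ (v m).1 → t (m + 1) - t m ≤ η)

end

/-- A simple loop of the digraph with edge set `E`: a directed closed path of length `len ≥ 1`,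
presented as a `len`-periodic vertex sequence, all of whose vertices (within one period) are
distinct, whose consecutive vertices are joined by edges of `E`. -/
structure SimpleLoop (k : ℕ) (E : Set (Fin k × Fin k)) : Type where
  len : ℕ
  pos : 0 < len
  vtx : ℕ → Fin k
  periodic : ∀ j, vtx (j + len) = vtx j
  inj : ∀ a b, a < len → b < len → vtx a = vtx b → a = b
  edge : ∀ j, (vtx j, vtx (j + 1)) ∈ E

/-- The edge set of a simple loop. -/
def loopEdges {k : ℕ} {E : Set (Fin k × Fin k)} (c : SimpleLoop k E) : Set (Fin k × Fin k) :=
  {e | ∃ j < c.len, e = (c.vtx j, c.vtx (j + 1))}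

section helpers

theorem aux_sNorm_nonneg {n : ℕ} (M : Matrix (Fin n) (Fin n) ℂ) : 0 ≤ sNorm M := norm_nonneg _

theorem aux_sNorm_mul {n : ℕ} (M N : Matrix (Fin n) (Fin n) ℂ) :
    sNorm (M * N) ≤ sNorm M * sNorm N := by
  unfold sNorm
  rw [map_mul]
  exact norm_mul_le _ _

theorem aux_sNorm_pos {n : ℕ} (hn : 0 < n) (M : Matrix (Fin n) (Fin n) ℂ) (h : IsUnit M) :
    0 < sNorm M := by
  unfold sNorm
  have : Nonempty (Fin n) := ⟨⟨0, hn⟩⟩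
  rw [norm_pos_iff]
  intro h0
  refine h.ne_zero ((Matrix.toEuclideanCLM (𝕜 := ℂ) (n := Fin n)).injective ?_)
  exact h0.trans (map_zero (Matrix.toEuclideanCLM (𝕜 := ℂ) (n := Fin n))).symm

theorem aux_norm_real {n : ℕ} (M : Matrix (Fin n) (Fin n) ℝ) (x : EuclideanSpace ℝ (Fin n)) :
    ‖Matrix.toEuclideanCLM (𝕜 := ℝ) M x‖ ≤ sNorm (M.map Complex.ofReal) * ‖x‖ := by
  have hc : ∀ y : EuclideanSpace ℝ (Fin n),
      ‖(WithLp.toLp 2 (fun i => (y i : ℂ)) : EuclideanSpace ℂ (Fin n))‖ = ‖y‖ := by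
    intro y
    simp [EuclideanSpace.norm_eq]
  rw [← hc x, ← hc (Matrix.toEuclideanCLM (𝕜 := ℝ) M x)]
  refine le_trans (le_of_eq ?_) ((Matrix.toEuclideanCLM (𝕜 := ℂ) (M.map Complex.ofReal)).le_opNorm _)
  congr 1
  ext i
  simp [Matrix.mulVec, dotProduct]

theorem aux_map_exp {n : ℕ} (M : Matrix (Fin n) (Fin n) ℝ) :
    (NormedSpace.exp M).map Complex.ofReal = NormedSpace.exp (M.map Complex.ofReal) := by
  open scoped Matrix.Norms.Operator in
  have := NormedSpace.map_exp (Complex.ofRealHom.mapMatrix (m := Fin n))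
    (by
      show Continuous fun M : Matrix (Fin n) (Fin n) ℝ => M.map Complex.ofReal
      exact continuous_id.matrix_map Complex.continuous_ofReal) M
  exact this

theorem aux_exp_eq {n : ℕ} (M : Matrix (Fin n) (Fin n) ℝ) (P D : Matrix (Fin n) (Fin n) ℂ)
    (h : Diagonalized M P D) (c : ℝ) :
    (NormedSpace.exp (c • M)).map Complex.ofReal
      = P * NormedSpace.exp ((c : ℂ) • D) * P⁻¹ := by
  rw [aux_map_exp, ← Matrix.exp_conj _ _ h.1]
  congr 1
  have : (c • M).map Complex.ofReal = (c : ℂ) • M.map Complex.ofReal := by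
    ext i j; simp
  rw [this, h.2.2]
  simp

theorem aux_exp_bound {n : ℕ} (M : Matrix (Fin n) (Fin n) ℝ) (P D : Matrix (Fin n) (Fin n) ℂ)
    (h : Diagonalized M P D) (a : ℝ) (ha : MaxRe M a) (c : ℝ) (hc : 0 ≤ c) :
    sNorm (NormedSpace.exp ((c : ℂ) • D)) ≤ Real.exp (a * c) := by
  obtain ⟨⟨U, rfl⟩, hD, hM⟩ := h
  have hspec : ∀ i, (D i i).re ≤ a := by
    intro i
    apply ha.2
    refine ⟨D i i, ?_, rfl⟩
    rw [hM, ← Matrix.coe_units_inv, spectrum.units_conjugate, ← hD.diagonal_diag,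
      spectrum_diagonal]
    exact ⟨i, by simp⟩
  obtain ⟨d, rfl⟩ : ∃ d, D = Matrix.diagonal d := ⟨_, hD.diagonal_diag.symm⟩
  have e1 : (c : ℂ) • Matrix.diagonal d = Matrix.diagonal ((c : ℂ) • d) := by
    simp
  rw [e1, Matrix.exp_diagonal]
  unfold sNorm
  open scoped Matrix.Norms.L2Operator in
  rw [Matrix.l2_opNorm_toEuclideanCLM, Matrix.l2_opNorm_diagonal]
  rw [pi_norm_le_iff_of_nonneg (Real.exp_pos _).le]
  intro i
  rw [Pi.coe_exp, ← Complex.exp_eq_exp_ℂ, Complex.norm_exp, Real.exp_le_exp]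
  have := hspec i
  simp at this
  simp
  nlinarith

/-- Combinatorial core. -/
theorem aux_walk {k : ℕ} (E : Set (Fin k × Fin k)) (w : Fin k × Fin k → ℝ) (B : ℝ) (hB : 0 ≤ B)
    (hwB : ∀ e, w e ≤ B)
    (hloop : ∀ c : SimpleLoop k E, ∑ j ∈ Finset.range c.len, w (c.vtx j, c.vtx (j + 1)) ≤ 0) :
    ∀ (m : ℕ) (v : ℕ → Fin k), (∀ j, (v j, v (j + 1)) ∈ E) →
      ∑ j ∈ Finset.range m, w (v j, v (j + 1)) ≤ k * B := by
  intro m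
  induction m using Nat.strong_induction_on with
  | _ m ih =>
  intro v hv
  by_cases hmk : m ≤ k
  · calc ∑ j ∈ Finset.range m, w (v j, v (j + 1)) ≤ ∑ j ∈ Finset.range m, B :=
          Finset.sum_le_sum fun j _ => hwB _
      _ = m * B := by simp
      _ ≤ k * B := by gcongr
  push Not at hmk
  have hex : ∃ b, b ≤ k ∧ ∃ a < b, v a = v b := by
    obtain ⟨x, y, hxy, he⟩ := Fintype.exists_ne_map_eq_of_card_lt
      (fun i : Fin (k + 1) => v i) (by simp)
    rcases lt_or_gt_of_ne hxy with h | h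
    · exact ⟨y, by omega, x, h, he⟩
    · exact ⟨x, by omega, y, h, he.symm⟩
  classical
  obtain ⟨hbk, a, hab, hvab⟩ := Nat.find_spec hex
  have hmin : ∀ b' < Nat.find hex, ∀ a' < b', v a' ≠ v b' := by
    intro b' hb' a' ha' h
    exact Nat.find_min hex hb' ⟨by omega, a', ha', h⟩
  generalize Nat.find hex = b at hbk hab hvab hmin
  obtain ⟨l, rfl⟩ : ∃ l, b = a + l := ⟨b - a, by omega⟩
  have hl : 0 < l := by omega
  have hstep : ∀ j, v (a + (j + 1) % l) = v (a + j % l + 1) := by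
    intro j
    have h1 := Nat.mod_lt j hl
    rcases Nat.lt_or_ge (j % l + 1) l with h | h
    · rw [Nat.add_mod, Nat.mod_eq_of_lt (a := 1) (by omega), Nat.mod_eq_of_lt h]
      rfl
    · have h2 : j % l + 1 = l := by omega
      have h3 : (j + 1) % l = 0 := by
        rw [← Nat.mod_add_mod, h2, Nat.mod_self]
      rw [h3, add_assoc, h2, add_zero, hvab]
  let c : SimpleLoop k E :=
    { len := l
      pos := hl
      vtx := fun j => v (a + j % l)
      periodic := by intro j; simp
      inj := by
        intro x y hx hy hxy
        simp only [Nat.mod_eq_of_lt hx, Nat.mod_eq_of_lt hy] at hxy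
        by_contra hne
        rcases lt_or_gt_of_ne hne with h | h
        · exact hmin (a + y) (by omega) (a + x) (by omega) hxy
        · exact hmin (a + x) (by omega) (a + y) (by omega) hxy.symm
      edge := by
        intro j
        simp only [hstep]
        exact hv _ }
  have hc : ∑ j ∈ Finset.range l, w (v (a + j), v (a + j + 1)) ≤ 0 := by
    refine le_trans (le_of_eq ?_) (hloop c)
    apply Finset.sum_congr rfl
    intro j hj
    have hj' : j < l := Finset.mem_range.mp hj
    simp only [c, hstep, Nat.mod_eq_of_lt hj']
  obtain ⟨q, rfl⟩ : ∃ q, m = a + l + q := ⟨m - (a + l), by omega⟩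
  let v' : ℕ → Fin k := fun j => if j < a then v j else v (j + l)
  have hlt : ∀ j, j < a → v' j = v j ∧ v' (j + 1) = v (j + 1) := by
    intro j hj
    refine ⟨by simp [v', hj], ?_⟩
    by_cases h : j + 1 < a
    · simp [v', h]
    · have : j + 1 = a := by omega
      simp [v', this, hvab]
  have hge : ∀ j, v' (a + j) = v (a + l + j) := by
    intro j
    simp only [v', show ¬ (a + j < a) by omega, if_false]
    congr 1; omega
  have hv' : ∀ j, (v' j, v' (j + 1)) ∈ E := by
    intro j
    by_cases h : j < a
    · rw [(hlt j h).1, (hlt j h).2]; exact hv j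
    · obtain ⟨i, rfl⟩ : ∃ i, j = a + i := ⟨j - a, by omega⟩
      rw [add_assoc, hge, hge]; exact hv _
  have key := ih (a + q) (by omega) v' hv'
  rw [Finset.sum_range_add] at key ⊢
  rw [Finset.sum_range_add]
  have e1 : ∑ x ∈ Finset.range a, w (v' x, v' (x + 1)) = ∑ x ∈ Finset.range a, w (v x, v (x + 1)) :=
    Finset.sum_congr rfl fun j hj => by
      rw [(hlt j (Finset.mem_range.mp hj)).1, (hlt j (Finset.mem_range.mp hj)).2]
  have e2 : ∑ x ∈ Finset.range q, w (v' (a + x), v' (a + x + 1))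
      = ∑ x ∈ Finset.range q, w (v (a + l + x), v (a + l + x + 1)) :=
    Finset.sum_congr rfl fun j hj => by
      rw [add_assoc a j 1, hge, hge]; rfl
  rw [e1, e2] at key
  linarith

theorem aux_loop_sum {k : ℕ} {E : Set (Fin k × Fin k)} (c d : SimpleLoop k E)
    (h : loopEdges c = loopEdges d) (w : Fin k × Fin k → ℝ) :
    ∑ j ∈ Finset.range c.len, w (c.vtx j, c.vtx (j + 1))
      = ∑ j ∈ Finset.range d.len, w (d.vtx j, d.vtx (j + 1)) := by
  classical
  have gen : ∀ c : SimpleLoop k E, ∑ j ∈ Finset.range c.len, w (c.vtx j, c.vtx (j + 1))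
      = ∑ e ∈ Finset.univ.filter (fun e => e ∈ loopEdges c), w e := by
    intro c
    refine Finset.sum_bij (fun j _ => (c.vtx j, c.vtx (j + 1))) ?_ ?_ ?_ ?_
    · intro j hj
      simp only [Finset.mem_filter, Finset.mem_univ, true_and]
      exact ⟨j, Finset.mem_range.mp hj, rfl⟩
    · intro x hx y hy hxy
      exact c.inj x y (Finset.mem_range.mp hx) (Finset.mem_range.mp hy) (Prod.ext_iff.mp hxy).1
    · intro e he
      simp only [Finset.mem_filter, Finset.mem_univ, true_and] at he
      obtain ⟨j, hj, rfl⟩ := he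
      exact ⟨j, Finset.mem_range.mpr hj, rfl⟩
    · intro _ _; rfl
  rw [gen c, gen d, h]

/-- Linear decay of walk weights. -/
theorem aux_decay {k p : ℕ} (E : Set (Fin k × Fin k)) (w : Fin k × Fin k → ℝ)
    (s : Fin p → SimpleLoop k E)
    (hcomplete : ∀ c : SimpleLoop k E, ∃ i : Fin p, loopEdges c = loopEdges (s i))
    (hneg : ∀ i, ∑ j ∈ Finset.range (s i).len, w ((s i).vtx j, (s i).vtx (j + 1)) < 0) :
    ∃ ε > 0, ∃ C : ℝ, ∀ (m : ℕ) (v : ℕ → Fin k), (∀ j, (v j, v (j + 1)) ∈ E) →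
      ∑ j ∈ Finset.range m, w (v j, v (j + 1)) ≤ C - ε * m := by
  have hε : ∃ ε > 0, ∀ i : Fin p, ε * (s i).len
      ≤ -∑ j ∈ Finset.range (s i).len, w ((s i).vtx j, (s i).vtx (j + 1)) := by
    have : ∀ i : Fin p, ∀ᶠ ε in 𝓝[>] (0 : ℝ), ε * (s i).len
        ≤ -∑ j ∈ Finset.range (s i).len, w ((s i).vtx j, (s i).vtx (j + 1)) := by
      intro i
      apply eventually_nhdsWithin_of_eventually_nhds
      have ht : Tendsto (fun ε : ℝ => ε * (s i).len) (𝓝 0) (𝓝 (0 * (s i).len)) :=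
        (continuous_id.mul continuous_const).tendsto _
      rw [zero_mul] at ht
      exact (ht.eventually_lt_const (neg_pos.mpr (hneg i))).mono fun _ h => h.le
    have h2 := (Filter.eventually_all.mpr this).and self_mem_nhdsWithin
    obtain ⟨ε, h, hp⟩ := h2.exists
    exact ⟨ε, hp, h⟩
  obtain ⟨ε, hε, hle⟩ := hε
  refine ⟨ε, hε, ?_⟩
  let B : ℝ := ∑ e, |w e + ε|
  have hw := aux_walk E (fun e => w e + ε) B (Finset.sum_nonneg fun _ _ => abs_nonneg _)
    (fun e => (le_abs_self _).trans
      (Finset.single_le_sum (f := fun e => |w e + ε|) (fun _ _ => abs_nonneg _)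
        (Finset.mem_univ e)))
    (by
      intro c
      obtain ⟨i, hi⟩ := hcomplete c
      rw [aux_loop_sum c (s i) hi (fun e => w e + ε), Finset.sum_add_distrib]
      have := hle i
      simp
      linarith [mul_comm ε ((s i).len : ℝ)])
  refine ⟨k * B, fun m v hv => ?_⟩
  have := hw m v hv
  rw [Finset.sum_add_distrib] at this
  simp at this
  linarith [mul_comm ε (m : ℝ)]

theorem aux_pc {α : Type*} (t : ℕ → ℝ) (ht : StrictMono t) (f : ℕ → α) (d : α) (s : ℝ)
    (m : ℕ) (h1 : t m ≤ s) (h2 : s < t (m + 1)) : pc t f d s = f m := by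
  unfold pc
  have hex : ∃ m, t m ≤ s ∧ s < t (m + 1) := ⟨m, h1, h2⟩
  rw [dif_pos hex]
  congr 1
  have h := hex.choose_spec
  have a1 := ht.lt_iff_lt.mp (h.1.trans_lt h2)
  have a2 := ht.lt_iff_lt.mp (h1.trans_lt h.2)
  omega

theorem aux_map_mul {n : ℕ} (M N : Matrix (Fin n) (Fin n) ℝ) :
    (M * N).map Complex.ofReal = M.map Complex.ofReal * N.map Complex.ofReal :=
  Matrix.map_mul (f := Complex.ofRealHom)

end helpers

/-- `s_1,…,s_p` are the simple loops of `G` (every simple loop has the edge set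
of some `s i`).  If for every simple loop `s i` one has
`ln ρ_i − λ_{s_i} τ + μ_{s_i} η < 0`, where `ρ_i` is the product of `‖P_v⁻¹P_u‖` over the
edges of `s i`, `λ_{s_i}` is the sum of the `λ_u` over edges with stable source and
`μ_{s_i}` the sum of the `μ_u` over edges with unstable source, then the switched system is
asymptotically stable for every signal in `S_G(τ, η)`. -/
theorem stability_loops_dwell_flee {n k p : ℕ} (E : Set (Fin k × Fin k))
    (r : ℕ) (hr : 1 ≤ r) (hrk : r < k)
    (A : Fin k → Matrix (Fin n) (Fin n) ℝ) (P D : Fin k → Matrix (Fin n) (Fin n) ℂ)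
    (hdiag : ∀ i, Diagonalized (A i) (P i) (D i))
    (hstab : ∀ i : Fin k, i.1 < r → MStable (A i))
    (hunst : ∀ i : Fin k, r ≤ i.1 → MUnstable (A i))
    (lam mu : Fin k → ℝ)
    (hlam : ∀ i : Fin k, i.1 < r → MaxRe (A i) (-(lam i)))
    (hmu : ∀ i : Fin k, r ≤ i.1 → MaxRe (A i) (mu i))
    (s : Fin p → SimpleLoop k E)
    (hcomplete : ∀ c : SimpleLoop k E, ∃ i : Fin p, loopEdges c = loopEdges (s i))
    (τ η : ℝ) (hτ : 0 < τ) (hη : 0 < η)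
    (hcond : ∀ i : Fin p,
      Real.log (∏ j ∈ Finset.range (s i).len,
          sNorm ((P ((s i).vtx (j + 1)))⁻¹ * P ((s i).vtx j))) -
        (∑ j ∈ (Finset.range (s i).len).filter (fun j => ((s i).vtx j).1 < r),
          lam ((s i).vtx j)) * τ +
        (∑ j ∈ (Finset.range (s i).len).filter (fun j => r ≤ ((s i).vtx j).1),
          mu ((s i).vtx j)) * η < 0)
    (t : ℕ → ℝ) (v : ℕ → Fin k) (hadm : Admissible E t v) (hsg : InSG r τ η t v) :
    AsympStable A t v := by
  obtain ⟨ht0, htm, htt, hvE⟩ := hadm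
  have hn : 0 < n := by
    rcases Nat.eq_zero_or_pos n with rfl | h
    · obtain ⟨z, hz, -⟩ := (hlam ⟨0, by omega⟩ (show 0 < r from hr)).1
      exact absurd hz (by
        rw [spectrum.of_subsingleton]
        simp)
    · exact h
  have hlampos : ∀ i : Fin k, i.1 < r → 0 < lam i := by
    intro i hi
    obtain ⟨z, hz, hz'⟩ := (hlam i hi).1
    have := hstab i hi z hz
    linarith
  have hmupos : ∀ i : Fin k, r ≤ i.1 → 0 < mu i := by
    intro i hi
    obtain ⟨z, hz, hz'⟩ := (hunst i hi).1
    have := (hmu i hi).2 ⟨z, hz, rfl⟩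
    linarith
  have hNpos : ∀ a b, 0 < sNorm ((P b)⁻¹ * P a) := by
    intro a b
    refine aux_sNorm_pos hn _ (IsUnit.mul ?_ (hdiag a).1)
    rw [Matrix.isUnit_nonsing_inv_iff]
    exact (hdiag b).1
  set g : Fin k → ℝ := fun u => if u.1 < r then -(lam u * τ) else mu u * η with hg
  set w : Fin k × Fin k → ℝ := fun e => Real.log (sNorm ((P e.2)⁻¹ * P e.1)) + g e.1 with hw
  obtain ⟨ε, hε, C, hC⟩ := aux_decay E w s hcomplete (by
    intro i
    refine lt_of_eq_of_lt ?_ (hcond i)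
    rw [Real.log_prod (fun j _ => (hNpos _ _).ne')]
    simp only [hw, hg, Finset.sum_add_distrib]
    rw [Finset.sum_ite, Finset.sum_neg_distrib, Finset.sum_mul, Finset.sum_mul]
    simp only [not_lt]
    ring)
  have hexp : ∀ (u : Fin k) (c : ℝ), 0 ≤ c → (u.1 < r → τ ≤ c) → (r ≤ u.1 → c ≤ η) →
      sNorm (NormedSpace.exp ((c : ℂ) • D u)) ≤ Real.exp (g u) := by
    intro u c hc h1 h2
    by_cases hu : u.1 < r
    · refine (aux_exp_bound _ _ _ (hdiag u) _ (hlam u hu) c hc).trans ?_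
      simp only [hg, hu, if_true]
      rw [Real.exp_le_exp]
      nlinarith [h1 hu, hlampos u hu]
    · push Not at hu
      refine (aux_exp_bound _ _ _ (hdiag u) _ (hmu u hu) c hc).trans ?_
      simp only [hg, hu.not_gt, if_false]
      rw [Real.exp_le_exp]
      nlinarith [h2 hu, hmupos u hu]
  have hexp' : ∀ (u : Fin k) (c : ℝ), 0 ≤ c → (r ≤ u.1 → c ≤ η) →
      sNorm (NormedSpace.exp ((c : ℂ) • D u)) ≤ Real.exp (|mu u| * η) := by
    intro u c hc h2
    by_cases hu : u.1 < r
    · refine (aux_exp_bound _ _ _ (hdiag u) _ (hlam u hu) c hc).trans ?_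
      rw [Real.exp_le_exp]
      have : 0 ≤ |mu u| * η := by positivity
      nlinarith [hlampos u hu]
    · push Not at hu
      refine (aux_exp_bound _ _ _ (hdiag u) _ (hmu u hu) c hc).trans ?_
      rw [Real.exp_le_exp, abs_of_pos (hmupos u hu)]
      nlinarith [h2 hu, hmupos u hu]
  set N : ℕ → Matrix (Fin n) (Fin n) ℂ :=
    fun m => (P (v m))⁻¹ * (flow A t v m).map Complex.ofReal with hN
  have hNb : ∀ m, sNorm (N m)
      ≤ Real.exp (∑ j ∈ Finset.range m, w (v j, v (j + 1))) * sNorm (N 0) := by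
    intro m
    induction m with
    | zero => simp
    | succ m ih =>
      have e : N (m + 1) = ((P (v (m + 1)))⁻¹ * P (v m)) *
          (NormedSpace.exp (((t (m + 1) - t m : ℝ) : ℂ) • D (v m)) * N m) := by
        simp only [hN, flow]
        rw [aux_map_mul, aux_exp_eq _ _ _ (hdiag (v m))]
        simp only [Matrix.mul_assoc]
      rw [e, Finset.sum_range_succ, Real.exp_add,
        mul_comm (Real.exp (∑ j ∈ Finset.range m, w (v j, v (j + 1))))]
      have hd := hexp (v m) (t (m + 1) - t m) (sub_nonneg.mpr (htm (Nat.lt_succ_self m)).le)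
        (hsg m).1 (hsg m).2
      have e2 : Real.exp (w (v m, v (m + 1)))
          = sNorm ((P (v (m + 1)))⁻¹ * P (v m)) * Real.exp (g (v m)) := by
        simp only [hw]
        rw [Real.exp_add, Real.exp_log (hNpos _ _)]
      rw [e2, mul_assoc (sNorm _ * _), mul_assoc (sNorm _)]
      refine (aux_sNorm_mul _ _).trans (mul_le_mul_of_nonneg_left ?_ (aux_sNorm_nonneg _))
      refine (aux_sNorm_mul _ _).trans ?_
      exact mul_le_mul hd ih (aux_sNorm_nonneg _) (Real.exp_pos _).le
  set K : ℝ := ∑ u, sNorm (P u) * Real.exp (|mu u| * η) with hK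
  have hKn : ∀ u, 0 ≤ sNorm (P u) * Real.exp (|mu u| * η) := fun u =>
    mul_nonneg (aux_sNorm_nonneg _) (Real.exp_pos _).le
  intro x0
  have hbound : ∀ m s', t m ≤ s' → s' < t (m + 1) →
      ‖sol A t v x0 s'‖ ≤ K * (Real.exp (C - ε * m) * sNorm (N 0)) * ‖x0‖ := by
    intro m s' h1 h2
    unfold sol
    rw [aux_pc t htm _ _ _ m h1 h2]
    refine (aux_norm_real _ _).trans (mul_le_mul_of_nonneg_right ?_ (norm_nonneg _))
    have e : (NormedSpace.exp ((s' - t m) • A (v m)) * flow A t v m).map Complex.ofReal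
        = P (v m) * NormedSpace.exp (((s' - t m : ℝ) : ℂ) • D (v m)) * N m := by
      simp only [hN]
      rw [aux_map_mul, aux_exp_eq _ _ _ (hdiag (v m))]
      simp only [Matrix.mul_assoc]
    rw [e]
    refine (aux_sNorm_mul _ _).trans ?_
    refine mul_le_mul ?_ ?_ (aux_sNorm_nonneg _) (Finset.sum_nonneg fun u _ => hKn u)
    · refine le_trans ?_ (Finset.single_le_sum (f := fun u => sNorm (P u) * Real.exp (|mu u| * η))
        (fun u _ => hKn u) (Finset.mem_univ (v m)))
      refine (aux_sNorm_mul _ _).trans (mul_le_mul_of_nonneg_left ?_ (aux_sNorm_nonneg _))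
      exact hexp' _ _ (by linarith) (fun h => by linarith [(hsg m).2 h])
    · refine (hNb m).trans (mul_le_mul_of_nonneg_right ?_ (aux_sNorm_nonneg _))
      rw [Real.exp_le_exp]
      exact hC m v hvE
  have hlim : Tendsto (fun m : ℕ => K * (Real.exp (C - ε * m) * sNorm (N 0)) * ‖x0‖) atTop (𝓝 0) := by
    have h1 : Tendsto (fun m : ℕ => Real.exp (C - ε * m)) atTop (𝓝 0) := by
      apply Real.tendsto_exp_atBot.comp
      apply tendsto_atBot_add_const_left atTop C
        (f := fun m : ℕ => -(ε * (m : ℝ))) _ |>.congr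
      · intro m; ring
      · exact tendsto_neg_atTop_atBot.comp (tendsto_natCast_atTop_atTop.const_mul_atTop hε)
    have := ((h1.mul_const (sNorm (N 0))).const_mul K).mul_const ‖x0‖
    simpa using this
  rw [Metric.tendsto_atTop] at hlim ⊢
  intro δ hδ
  obtain ⟨M, hM⟩ := hlim δ hδ
  refine ⟨t M, fun s' hs' => ?_⟩
  have hex : ∃ m, s' < t m := (htt.eventually_gt_atTop s').exists
  classical
  have hf := Nat.find_spec hex
  have hMlt : M < Nat.find hex := htm.lt_iff_lt.mp (hs'.trans_lt hf)
  obtain ⟨m, hm⟩ : ∃ m, Nat.find hex = m + 1 := ⟨Nat.find hex - 1, by omega⟩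
  have hlow : t m ≤ s' := not_lt.mp (Nat.find_min hex (m := m) (by omega))
  rw [hm] at hf
  have h3 := hbound m s' hlow hf
  have h4 := hM m (by omega)
  rw [Real.dist_eq, sub_zero] at h4 ⊢
  rw [abs_of_nonneg (norm_nonneg _)]
  exact h3.trans_lt ((le_abs_self _).trans_lt h4)
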